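/- (Proposition 2.2, chain lifting) Let X be a topological space with specialisation preorder ≤, let ⪯ be the partial order defined by x ⪯ y iff (x ≤ y and not y ≤ x) or x = y, and let s : SeparationQuotient X → X be any section of the quotient map (i.e., the quotient map composed with s is the identity). If c is a subset of SeparationQuotient X that is a chain with respect to the partial order induced on the quotient by ≤, then the image s '' c is a chain in X with respect to ⪯. -/

import Mathlib

/-- The partial order `x ⪯ y ↔ (x ≤ y ∧ ¬ y ≤ x) ∨ x = y` derived from the
specialisation preorder `≤` (`Specializes`). -/
def specPLE {X : Type*} [TopologicalSpace X] (x y : X) : Prop :=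
  (x ⤳ y ∧ ¬ y ⤳ x) ∨ x = y

/-- **Proposition 2.2, chain lifting.** Let `X` be a topological space with
specialisation preorder `≤`, let `⪯` be the partial order `x ⪯ y ↔ (x ≤ y ∧ ¬ y ≤ x) ∨ x = y`,
and let `s : SeparationQuotient X → X` be any section of the quotient map.  If `c` is a
subset of `SeparationQuotient X` that is a chain with respect to the partial order `R`
induced on the quotient by `≤`, then the image `s '' c` is a chain in `X` w.r.t. `⪯`. -/
theorem section_image_of_chain_isChain {X : Type*} [TopologicalSpace X]
    (R : SeparationQuotient X → SeparationQuotient X → Prop)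
    (hR : ∀ x y : X, R (SeparationQuotient.mk x) (SeparationQuotient.mk y) ↔ x ⤳ y)
    (s : SeparationQuotient X → X) (hs : SeparationQuotient.mk ∘ s = id)
    (c : Set (SeparationQuotient X)) (hc : IsChain R c) :
    IsChain specPLE (s '' c) := by
  have hmk : ∀ a, SeparationQuotient.mk (s a) = a := congrFun hs
  have hR_iff : ∀ a b, R a b ↔ s a ⤳ s b := fun a b => by
    rw [← hR, hmk, hmk]
  have hanti : ∀ {a b}, s a ⤳ s b → s b ⤳ s a → a = b := fun {a b} hab hba => by
    rw [← hmk a, ← hmk b]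
    exact SeparationQuotient.mk_eq_mk.2 (hab.antisymm hba)
  rintro _ ⟨a, ha, rfl⟩ _ ⟨b, hb, rfl⟩ hne
  have hab : a ≠ b := fun h => hne (congrArg s h)
  rcases hc ha hb hab with h | h
  · have h' := (hR_iff a b).1 h
    exact Or.inl (Or.inl ⟨h', fun hba => hab (hanti h' hba)⟩)
  · have h' := (hR_iff b a).1 h
    exact Or.inr (Or.inl ⟨h', fun hba => hab (hanti hba h')⟩)
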